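/- arXiv:2505.00262 — 2 statements merged into one kernel-verified Lean document; each statement's English description precedes it below -/
import Mathlib

section
/- Suppose the HNN-extension 𝔼 = ⟨B, t; t⁻¹Ht = K, φ⟩ satisfies condition (*) and 𝒞 is a root class of groups. If L ∈ 𝒞, B/H ∈ 𝒞, B/K ∈ 𝒞, B/HK ∈ 𝒞, Aut_𝔼(L) ∈ 𝒞, and Aut_{𝔹_{K,H}}(HK/K) ∈ 𝒞, then there exists a homomorphism of 𝔼 onto a group from 𝒞 acting injectively on B. -/
universe u

open Subgroup

/-- A class of groups in universe `u`: a property of groups. -/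
abbrev GroupClass : Type (u + 1) := (G : Type u) → [inst : Group G] → Prop

/-- The class is closed under isomorphism. -/
def IsoClosed (C : GroupClass.{u}) : Prop :=
  ∀ (G₁ G₂ : Type u) [Group G₁] [Group G₂], (G₁ ≃* G₂) → C G₁ → C G₂

/-- The class is closed under taking subgroups. -/
def SubgroupClosed (C : GroupClass.{u}) : Prop :=
  ∀ (G : Type u) [Group G] (H : Subgroup G), C G → C H

/-- The class is closed under taking quotient groups. -/
def QuotClosed (C : GroupClass.{u}) : Prop :=
  ∀ (G : Type u) [Group G] (N : Subgroup G) [N.Normal], C G → C (G ⧸ N)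

/-- The class is closed under direct products of a finite number of factors. -/
def FinProdClosed (C : GroupClass.{u}) : Prop :=
  ∀ (ι : Type u) [Finite ι] (G : ι → Type u) [∀ i, Group (G i)],
    (∀ i, C (G i)) → C (∀ i, G i)

/-- Gruenberg's condition. -/
def Gruenberg (C : GroupClass.{u}) : Prop :=
  ∀ (X : Type u) [Group X] (Y Z : Subgroup X) (_ : Z ≤ Y) (hY : Y.Normal)
    (hZY : (Z.subgroupOf Y).Normal), C (X ⧸ Y) → C (↥Y ⧸ Z.subgroupOf Y) →
    ∃ T : Subgroup X, ∃ _ : T.Normal, T ≤ Z ∧ C (X ⧸ T)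

/-- A root class of groups. -/
def IsRootClass (C : GroupClass.{u}) : Prop :=
  IsoClosed C ∧ (∃ (G : Type u) (_ : Group G), C G ∧ Nontrivial G) ∧
    SubgroupClosed C ∧ Gruenberg C

/-- `X` is residually a `C`-group. -/
def Residually (C : GroupClass.{u}) (X : Type u) [Group X] : Prop :=
  ∀ x : X, x ≠ 1 → ∃ (G : Type u) (_ : Group G) (f : X →* G),
    Function.Surjective f ∧ C G ∧ f x ≠ 1

/-- Every element has finite order. -/
def Periodic (G : Type u) [Group G] : Prop := ∀ g : G, IsOfFinOrder g

/-- The class consists only of periodic groups. -/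
def PeriodicClass (C : GroupClass.{u}) : Prop := ∀ (G : Type u) [Group G], C G → Periodic G

/-- `Aut_X(Y)`: the subgroup of `Aut(Y)` consisting of the restrictions to `Y`
of the inner automorphisms of `X` (that leave `Y` invariant; when `Y` is normal
in `X` these are the restrictions of all inner automorphisms of `X`). -/
def autOf (X : Type u) [Group X] (Y : Subgroup X) : Subgroup (MulAut Y) where
  carrier := { α | ∃ x : X, ∀ y : Y, ((α y : Y) : X) = x * y * x⁻¹ }
  one_mem' := ⟨1, fun y => by simp⟩
  mul_mem' := by
    rintro α β ⟨a, ha⟩ ⟨b, hb⟩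
    refine ⟨a * b, fun y => ?_⟩
    have h1 : ((α (β y) : Y) : X) = a * (β y) * a⁻¹ := ha (β y)
    have h2 : ((β y : Y) : X) = b * y * b⁻¹ := hb y
    show ((α (β y) : Y) : X) = _
    rw [h1, h2]; group
  inv_mem' := by
    rintro α ⟨a, ha⟩
    refine ⟨a⁻¹, fun y => ?_⟩
    have h : ((α (α⁻¹ y) : Y) : X) = a * (α⁻¹ y) * a⁻¹ := ha (α⁻¹ y)
    rw [MulAut.apply_inv_self] at h
    rw [h]; group

/-- Conjugation of automorphism groups along an isomorphism `φ : H ≃* K`,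
giving `φ ∘ α ∘ φ⁻¹ : Aut K →* Aut H`. -/
def autConjHom {H K : Type u} [Group H] [Group K] (φ : H ≃* K) : MulAut K →* MulAut H where
  toFun α := (φ.trans α).trans φ.symm
  map_one' := by ext x; simp
  map_mul' := fun α β => by
    ext x
    simp [MulAut.mul_apply, MulEquiv.trans_apply, MulEquiv.apply_symm_apply]

/-- `N ∈ 𝒞*(X)`: `N` is normal in `X` and `X/N ∈ 𝒞`. -/
def inCStar (C : GroupClass.{u}) (X : Type u) [Group X] (N : Subgroup X) : Prop :=
  ∃ _ : N.Normal, C (X ⧸ N)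

/-- `X` is `𝒞`-quasi-regular with respect to its subgroup `Y`. -/
def QuasiRegular (C : GroupClass.{u}) (X : Type u) [Group X] (Y : Subgroup X) : Prop :=
  ∀ M : Subgroup Y, inCStar C Y M → ∃ N : Subgroup X, inCStar C X N ∧ N.subgroupOf Y ≤ M

/-- `𝔓(𝒞)`: the set of primes dividing the order of some element of some `𝒞`-group. -/
def primesOf (C : GroupClass.{u}) : Set ℕ :=
  { p | p.Prime ∧ ∃ (Z : Type u) (_ : Group Z), C Z ∧ ∃ z : Z, p ∣ orderOf z }

/-- `Y` is `𝔓(𝒞)′`-isolated in `X`. -/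
def PIsolated (C : GroupClass.{u}) {X : Type u} [Group X] (Y : Subgroup X) : Prop :=
  ∀ (x : X) (q : ℕ), q.Prime → q ∉ primesOf C → x ^ q ∈ Y → x ∈ Y

/-- Every finitely generated subgroup is cyclic. -/
def LocallyCyclic (G : Type u) [Group G] : Prop :=
  ∀ S : Subgroup G, S.FG → IsCyclic S

/-- `A` is a `𝒞`-bounded abelian group. -/
def CBoundedAbelian (C : GroupClass.{u}) (A : Type u) [Group A] : Prop :=
  (∀ a b : A, a * b = b * a) ∧
  ∀ (N : Subgroup A), ∀ _ : N.Normal, ∀ p ∈ primesOf C,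
    (∃ m : ℕ, 0 < m ∧ ∀ x : A ⧸ N, (∃ n : ℕ, x ^ p ^ n = 1) → x ^ m = 1) ∧
    (∃ (Z : Type u) (_ : Group Z), C Z ∧
      Cardinal.mk {x : A ⧸ N // ∃ n : ℕ, x ^ p ^ n = 1} ≤ Cardinal.mk Z)

/-- `X` is a `𝒞`-bounded nilpotent group: it has a finite central series with
`𝒞`-bounded abelian factors. -/
def CBoundedNilpotent (C : GroupClass.{u}) (X : Type u) [Group X] : Prop :=
  ∃ (n : ℕ) (S : ℕ → Subgroup X), S 0 = ⊥ ∧ S n = ⊤ ∧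
    (∀ i < n, S i ≤ S (i + 1)) ∧ (∀ i < n, (S i).Normal) ∧
    (∀ i < n, ∀ x ∈ S (i + 1), ∀ g : X, g⁻¹ * x⁻¹ * g * x ∈ S i) ∧
    (∀ i < n, ∀ _ : ((S i).subgroupOf (S (i + 1))).Normal,
      CBoundedAbelian C (↥(S (i + 1)) ⧸ (S i).subgroupOf (S (i + 1))))

/-- `A` is a normal subgroup of `U` (as subgroups of a common group). -/
def NormalIn {G : Type u} [Group G] (A U : Subgroup G) : Prop := (A.subgroupOf U).Normal

/-- `G` satisfies a non-trivial identity. -/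
def SatisfiesNontrivialIdentity (G : Type u) [Group G] : Prop :=
  ∃ w : FreeGroup ℕ, w ≠ 1 ∧ ∀ f : FreeGroup ℕ →* G, f w = 1

section HNN

variable {B : Type u} [Group B] (H K : Subgroup B) (φ : H ≃* K)

/-- `𝔎 = φ ∘ Aut_B(K) ∘ φ⁻¹`, as a subgroup of `Aut(H)`. -/
def frakK : Subgroup (MulAut H) := (autOf B K).map (autConjHom φ)

/-- `𝔘 = ⟨𝔥, 𝔎⟩ ≤ Aut(H)`. -/
def frakU : Subgroup (MulAut H) := autOf B H ⊔ frakK H K φ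

/-- `𝔙 = ⟨𝔏, 𝔉⟩ ≤ Aut(L)`, where `ψ = φ|_L`. -/
def frakV (ψ : MulAut ↥(H ⊓ K)) : Subgroup (MulAut ↥(H ⊓ K)) :=
  autOf B (H ⊓ K) ⊔ Subgroup.zpowers ψ

/-- `ψ` is the restriction of `φ` to `L = H ⊓ K` (this encodes the
`φ`-invariance of `L` from condition (*)). -/
def IsRestrictionToL (ψ : MulAut ↥(H ⊓ K)) : Prop :=
  ∀ x : ↥(H ⊓ K), ((ψ x : ↥(H ⊓ K)) : B) = ((φ ⟨(x : B), x.2.1⟩ : K) : B)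

/-- `(H ⊓ K)φ = H ⊓ K` : the `φ`-invariance of `L` from condition (*). -/
def PhiInvL : Prop :=
  ((H ⊓ K).subgroupOf H).map φ.toMonoidHom = (H ⊓ K).subgroupOf K

end HNN

section HNNExtra

variable (C : GroupClass.{u}) {B : Type u} [Group B] (H K : Subgroup B) (φ : H ≃* K)

/-- Condition (†): at least one of `𝔥` and `𝔎` is normal in `𝔘`, or `𝔘 ∈ 𝒞`. -/
def CondDag : Prop :=
  NormalIn (autOf B H) (frakU H K φ) ∨ NormalIn (frakK H K φ) (frakU H K φ) ∨
    C ↥(frakU H K φ)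

/-- Condition (‡): at least one of `𝔏` and `𝔉` is normal in `𝔙`, or `𝔙 ∈ 𝒞`. -/
def CondDDag (ψ : MulAut ↥(H ⊓ K)) : Prop :=
  NormalIn (autOf B (H ⊓ K)) (frakV H K ψ) ∨
    NormalIn (Subgroup.zpowers ψ) (frakV H K ψ) ∨ C ↥(frakV H K ψ)

/-- `Q` is a pre-`𝒞`-admissible subgroup of `B`: it is normal, `(H,K,φ)`-compatible,
`B/Q ∈ 𝒞`, and `HQ/Q ∩ KQ/Q = LQ/Q`. -/
def PreAdmissible (Q : Subgroup B) : Prop :=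
  ∃ _ : Q.Normal, ((Q ⊓ H).subgroupOf H).map φ.toMonoidHom = (Q ⊓ K).subgroupOf K ∧
    C (B ⧸ Q) ∧
    (H.map (QuotientGroup.mk' Q)) ⊓ (K.map (QuotientGroup.mk' Q)) =
      (H ⊓ K).map (QuotientGroup.mk' Q)

end HNNExtra


section BKH

variable {B : Type u} [Group B]

/-- The two factors `B/H` and `B/K` of the amalgamated product `𝔹_{K,H}`. -/
def BKHfactors (H K : Subgroup B) [H.Normal] [K.Normal] : Bool → Type u :=
  fun b => cond b (B ⧸ K) (B ⧸ H)

instance (H K : Subgroup B) [H.Normal] [K.Normal] : ∀ b, Group (BKHfactors H K b) :=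
  fun b => by
    cases b
    · exact inferInstanceAs (Group (B ⧸ H))
    · exact inferInstanceAs (Group (B ⧸ K))

/-- The two maps from a copy of `H` (whose images are the amalgamated subgroups
`HK/K ≤ B/K` and `KH/H ≤ B/H`), namely `h ↦ hK` and `h ↦ (hφ)H`; the resulting
pushout identifies `hK` with `(hφ)H`, i.e. amalgamates along `φ_{K,H}`. -/
def BKHmaps (H K : Subgroup B) (φ : H ≃* K) [H.Normal] [K.Normal] :
    ∀ b, ↥H →* BKHfactors H K b
  | false => (QuotientGroup.mk' H).comp (K.subtype.comp φ.toMonoidHom)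
  | true => (QuotientGroup.mk' K).comp H.subtype

/-- The amalgamated free product `𝔹_{K,H} = ⟨(B/K) * (B/H); HK/K = KH/H, φ_{K,H}⟩`. -/
def BKH (H K : Subgroup B) (φ : H ≃* K) [H.Normal] [K.Normal] : Type u :=
  Monoid.PushoutI (BKHmaps H K φ)

instance (H K : Subgroup B) (φ : H ≃* K) [H.Normal] [K.Normal] : Group (BKH H K φ) :=
  inferInstanceAs (Group (Monoid.PushoutI _))

/-- The amalgamated subgroup `HK/K` of `𝔹_{K,H}`. -/
def BKHamalg (H K : Subgroup B) (φ : H ≃* K) [H.Normal] [K.Normal] :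
    Subgroup (BKH H K φ) :=
  MonoidHom.range (Monoid.PushoutI.base (BKHmaps H K φ))

end BKH

section RootClass

variable {C : GroupClass.{u}}

theorem IsRootClass.of_mulEquiv (hC : IsRootClass C) {G₁ G₂ : Type u} [Group G₁] [Group G₂]
    (e : G₁ ≃* G₂) (h : C G₁) : C G₂ :=
  hC.1 G₁ G₂ e h

theorem IsRootClass.of_subgroup (hC : IsRootClass C) {G : Type u} [Group G] (S : Subgroup G)
    (h : C G) : C S :=
  hC.2.2.1 G S h

theorem IsRootClass.of_injective (hC : IsRootClass C) {G₁ G₂ : Type u} [Group G₁] [Group G₂]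
    (f : G₁ →* G₂) (hf : Function.Injective f) (h : C G₂) : C G₁ :=
  hC.of_mulEquiv (MonoidHom.ofInjective hf).symm (hC.of_subgroup f.range h)

/-- Gruenberg's condition phrased in terms of homomorphisms. -/
theorem IsRootClass.exists_normal_le (hC : IsRootClass C) {X Q D : Type u} [Group X] [Group Q]
    [Group D] (p : X →* Q) (q : p.ker →* D) (hQ : C Q) (hD : C D) :
    ∃ T : Subgroup X, ∃ _ : T.Normal,
      (∀ x ∈ T, ∃ hx : x ∈ p.ker, q ⟨x, hx⟩ = 1) ∧ C (X ⧸ T) := by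
  have hsub : (q.ker.map p.ker.subtype).subgroupOf p.ker = q.ker := by
    ext x; simp [Subgroup.mem_subgroupOf]
  have hnormal : ((q.ker.map p.ker.subtype).subgroupOf p.ker).Normal := by
    rw [hsub]; infer_instance
  obtain ⟨T, hT, hle, hCT⟩ := hC.2.2.2 X p.ker (q.ker.map p.ker.subtype)
    (Subgroup.map_subtype_le _) inferInstance hnormal
    (hC.of_injective (QuotientGroup.kerLift p) (QuotientGroup.kerLift_injective p) hQ)
    (hC.of_mulEquiv (QuotientGroup.quotientMulEquivOfEq hsub).symm
      (hC.of_injective (QuotientGroup.kerLift q) (QuotientGroup.kerLift_injective q) hD))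
  refine ⟨T, hT, fun x hx => ?_, hCT⟩
  obtain ⟨⟨y, hy⟩, hyq, rfl⟩ := hle hx
  exact ⟨hy, hyq⟩

/-- A group lies in the root class if it has homomorphisms `p` to a group of the class and `q` from
`p.ker` to a group of the class such that no nontrivial normal subgroup lies below `q.ker`. -/
theorem IsRootClass.of_ker_core_trivial (hC : IsRootClass C) {X Q D : Type u} [Group X] [Group Q]
    [Group D] (p : X →* Q) (q : p.ker →* D) (hQ : C Q) (hD : C D)
    (hcore : ∀ x : X, (∀ g : X, ∃ hx : g * x * g⁻¹ ∈ p.ker, q ⟨g * x * g⁻¹, hx⟩ = 1) → x = 1) :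
    C X := by
  obtain ⟨T, hT, hle, hCT⟩ := hC.exists_normal_le p q hQ hD
  obtain rfl : T = ⊥ := (Subgroup.eq_bot_iff_forall T).2 fun x hx =>
    hcore x fun g => hle _ (hT.conj_mem x hx g)
  exact hC.of_mulEquiv QuotientGroup.quotientBot hCT

theorem IsRootClass.semidirectProduct (hC : IsRootClass C) {N A : Type u} [Group N] [Group A]
    (φ : A →* MulAut N) (hN : C N) (hA : C A) : C (N ⋊[φ] A) := by
  refine hC.of_ker_core_trivial (SemidirectProduct.rightHom : N ⋊[φ] A →* A)
    { toFun := fun x => x.1.left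
      map_one' := rfl
      map_mul' := fun x y => by
        have hx : x.1.right = 1 := x.2
        simp [hx] } hA hN fun x hx => ?_
  obtain ⟨h1, h2⟩ := hx 1
  simp only [one_mul, inv_one, mul_one, MonoidHom.coe_mk, OneHom.coe_mk] at h1 h2
  exact SemidirectProduct.ext h2 h1

theorem IsRootClass.regularWreathProduct (hC : IsRootClass C) {D Q : Type u} [Group D] [Group Q]
    (hD : C D) (hQ : C Q) : C (RegularWreathProduct D Q) := by
  refine hC.of_ker_core_trivial (RegularWreathProduct.rightHom : RegularWreathProduct D Q →* Q)
    { toFun := fun x => x.1.left 1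
      map_one' := rfl
      map_mul' := fun x y => by
        have hx : x.1.right = 1 := x.2
        simp [hx] } hQ hD fun x hx => ?_
  have hr : x.right = 1 := by
    have h := (hx 1).1
    simpa using h
  refine RegularWreathProduct.ext (funext fun s => ?_) hr
  have h := (hx (RegularWreathProduct.inl s⁻¹)).2
  simpa [hr] using h

end RootClass

section Wreath

/-- A choice of representatives for the action of `V` on `S` through `f`. -/
theorem exists_section_orbits {V S : Type*} [Group V] [Group S] (f : V →* S) :
    ∃ σ : S → V, ∀ v s, (σ s)⁻¹ * v * σ ((f v)⁻¹ * s) ∈ f.ker := by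
  let r : S → Quotient (QuotientGroup.rightRel f.range) := fun s => Quotient.mk _ s
  have hr : ∀ s, ∃ v, f v = s * (r s).out⁻¹ := fun s => by
    have h : QuotientGroup.rightRel f.range (r s).out s := Quotient.mk_out s
    exact QuotientGroup.rightRel_apply.1 h
  have hrmul : ∀ v s, r ((f v)⁻¹ * s) = r s := fun v s =>
    Quotient.sound (QuotientGroup.rightRel_apply.2 ⟨v, by simp⟩)
  choose σ hσ using hr
  exact ⟨σ, fun v s => by simp [MonoidHom.mem_ker, hσ, hrmul, mul_assoc]⟩

/-- A Kaluzhnin–Krasner type embedding whose restriction to `f.ker` is diagonal: if `α` extends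
to `V` the conjugation action on the image of `j : f.ker →* P`, then `j` extends to a homomorphism
of `V` to the wreath product of `P` with `S`. -/
theorem exists_hom_wreath_diagonal {V S P : Type*} [Group V] [Group S] [Group P] (f : V →* S)
    (α : V →* P) (j : f.ker →* P)
    (hj : ∀ v n, α v * j n * (α v)⁻¹ = j (MulAut.conjNormal v n)) :
    ∃ F : V →* RegularWreathProduct P S, (∀ v, (F v).right = f v) ∧
      ∀ n : f.ker, (F n).left = fun _ => j n := by
  obtain ⟨σ, hmem⟩ := exists_section_orbits f
  obtain ⟨J, hJ⟩ : ∃ J : V → S → P, ∀ v s, J v s = j ⟨_, hmem v s⟩ := ⟨_, fun _ _ => rfl⟩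
  have hs : ∀ v w s, (f (v * w))⁻¹ * s = (f w)⁻¹ * ((f v)⁻¹ * s) := fun v w s => by
    simp [mul_assoc]
  have hJmul : ∀ v w s, J (v * w) s = J v s * J w ((f v)⁻¹ * s) := fun v w s => by
    simp only [hJ, ← map_mul]
    congr 1
    ext
    simp [mul_assoc]
  refine ⟨MonoidHom.mk' (fun v => ⟨fun s => α (σ s) * J v s * (α (σ ((f v)⁻¹ * s)))⁻¹, f v⟩)
    fun v w => RegularWreathProduct.ext (funext fun s => ?_) (map_mul f v w), fun _ => rfl,
    fun n => funext fun s => ?_⟩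
  · simp only [RegularWreathProduct.mul_left, Pi.mul_apply, hJmul, hs]
    group
  · have hn : (f (n : V))⁻¹ * s = s := by
      rw [show f n = 1 from n.2]
      simp
    simp only [MonoidHom.mk'_apply, hn, hJ, hj]
    congr 1
    ext
    simp [mul_assoc]

/-- Two homomorphisms to a wreath product that agree modulo the base and agree on the preimage of
the base are conjugate by an element of the base. -/
theorem exists_conj_of_agree {V S P : Type*} [Group V] [Group S] [Group P]
    (F₁ F₂ : V →* RegularWreathProduct P S) (hright : ∀ v, (F₁ v).right = (F₂ v).right)
    (hker : ∀ v, (F₁ v).right = 1 → F₁ v = F₂ v) :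
    ∃ κ : RegularWreathProduct P S, κ.right = 1 ∧ ∀ v, κ * F₁ v = F₂ v * κ := by
  let f : V →* S := RegularWreathProduct.rightHom.comp F₁
  have hf₁ : ∀ v, (F₁ v).right = f v := fun _ => rfl
  have hf₂ : ∀ v, (F₂ v).right = f v := fun v => (hright v).symm
  have hindep : ∀ v w, f v = f w → ∀ s,
      (F₂ v).left s * ((F₁ v).left s)⁻¹ = (F₂ w).left s * ((F₁ w).left s)⁻¹ := by
    intro v w hvw s
    have h : F₁ (w⁻¹ * v) = F₂ (w⁻¹ * v) := hker _ (by rw [hf₁]; simp [hvw])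
    obtain ⟨l, rfl⟩ : ∃ l, v = w * l := ⟨w⁻¹ * v, by simp⟩
    simp only [inv_mul_cancel_left] at h
    simp only [map_mul, RegularWreathProduct.mul_left, Pi.mul_apply, h, hf₁, hf₂]
    group
  obtain ⟨η, hη⟩ := exists_section_orbits f
  refine ⟨⟨fun s => (F₂ (η s)).left s * ((F₁ (η s)).left s)⁻¹, 1⟩, rfl, fun v => ?_⟩
  refine RegularWreathProduct.ext (funext fun s => ?_) (by simp [hright])
  have h := hindep (η s) (v * η ((f v)⁻¹ * s)) (by
    have hm := hη v s
    rwa [MonoidHom.mem_ker, mul_assoc, map_mul, map_inv, inv_mul_eq_one] at hm) s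
  simp only [RegularWreathProduct.mul_left, Pi.mul_apply, h, map_mul, hf₁, hf₂, inv_one, one_mul]
  group

end Wreath

section Holomorph

variable {X : Type u} [Group X] (Y : Subgroup X)

/-- The semidirect product `Y ⋊ Aut_X(Y)`. -/
abbrev AutExtension : Type u := ↥Y ⋊[(autOf X Y).subtype] ↥(autOf X Y)

variable [Y.Normal]

/-- The action of `X` on its normal subgroup `Y` by conjugation. -/
def conjAutOf : X →* autOf X Y :=
  MulAut.conjNormal.codRestrict (autOf X Y) fun x => ⟨x, fun y => by simp⟩

@[simp]
theorem coe_conjAutOf_apply (x : X) (y : Y) :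
    (((conjAutOf Y x : MulAut Y) y : Y) : X) = x * y * x⁻¹ :=
  MulAut.conjNormal_apply x y

/-- If `ι` maps the kernel of `f` into `Y`, then its restriction to this kernel extends to a
homomorphism of `V` to the wreath product of `Y ⋊ Aut_X(Y)` with the codomain of `f`. -/
theorem exists_hom_wreath_autExtension {V S : Type*} [Group V] [Group S] (ι : V →* X)
    (f : V →* S) (hι : ∀ v ∈ f.ker, ι v ∈ Y) :
    ∃ F : V →* RegularWreathProduct (AutExtension Y) S, (∀ v, (F v).right = f v) ∧
      (∀ v (hv : v ∈ f.ker), F v = ⟨fun _ => SemidirectProduct.inl ⟨ι v, hι v hv⟩, 1⟩) ∧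
      ∀ v, F v = 1 ↔ v ∈ f.ker ∧ ι v = 1 := by
  have hι' : ∀ v : f.ker, (ι.comp f.ker.subtype) v ∈ Y := fun v => hι v v.2
  obtain ⟨F, hF, hF'⟩ := exists_hom_wreath_diagonal f
    (SemidirectProduct.inr.comp ((conjAutOf Y).comp ι) : V →* AutExtension Y)
    (SemidirectProduct.inl.comp ((ι.comp f.ker.subtype).codRestrict Y hι')) (by
      intro v n
      have h := SemidirectProduct.inl_aut (φ := (autOf X Y).subtype) (conjAutOf Y (ι v))
        ((ι.comp f.ker.subtype).codRestrict Y hι' n)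
      rw [map_inv] at h
      refine h.symm.trans (congrArg _ (Subtype.ext ?_))
      simp)
  have hdiag : ∀ v (hv : v ∈ f.ker),
      F v = ⟨fun _ => SemidirectProduct.inl ⟨ι v, hι v hv⟩, 1⟩ := fun v hv =>
    RegularWreathProduct.ext (hF' ⟨v, hv⟩) ((hF v).trans hv)
  refine ⟨F, hF, hdiag, fun v => ⟨fun hv => ?_, fun ⟨hv, hv'⟩ => ?_⟩⟩
  · have hvk : v ∈ f.ker := by rw [MonoidHom.mem_ker, ← hF, hv, RegularWreathProduct.one_right]
    rw [hdiag v hvk] at hv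
    have h := congrFun (congrArg RegularWreathProduct.left hv) 1
    exact ⟨hvk, congrArg Subtype.val (SemidirectProduct.inl_injective (h.trans (map_one _).symm))⟩
  · rw [hdiag v hv]
    refine RegularWreathProduct.ext (funext fun s => ?_) rfl
    simp only [hv']
    exact map_one _

end Holomorph

section BKHLemmas

/-- The factors embed in a pushout of groups as soon as the amalgamated maps have a common
kernel. -/
theorem pushoutI_of_injective_of_ker_eq {ι : Type*} {G : ι → Type*} {A : Type*}
    [∀ i, Group (G i)] [Group A] {φ : ∀ i, A →* G i} {N : Subgroup A} [N.Normal]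
    (hφ : ∀ i, (φ i).ker = N) (i : ι) :
    Function.Injective (Monoid.PushoutI.of i : G i →* Monoid.PushoutI φ) := by
  let m : ∀ i, A ⧸ N →* G i := fun i => QuotientGroup.lift N (φ i) (hφ i).ge
  have hm : ∀ i, Function.Injective (m i) := fun i => by
    rw [injective_iff_map_eq_one]
    intro x hx
    induction x using QuotientGroup.induction_on with
    | H a => exact (QuotientGroup.eq_one_iff a).2 ((hφ i).le hx)
  let F : Monoid.PushoutI φ →* Monoid.PushoutI m :=
    Monoid.PushoutI.lift (fun i => Monoid.PushoutI.of i)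
      ((Monoid.PushoutI.base m).comp (QuotientGroup.mk' N)) fun i =>
        MonoidHom.ext fun a => Monoid.PushoutI.of_apply_eq_base m i (QuotientGroup.mk' N a)
  refine Function.Injective.of_comp (f := F) fun x y hxy => ?_
  exact Monoid.PushoutI.of_injective hm i (by simpa [F] using hxy)

variable {B : Type u} [Group B] (H K : Subgroup B) (φ : H ≃* K) [H.Normal] [K.Normal]

theorem PhiInvL.apply_mem_iff {H K : Subgroup B} {φ : H ≃* K} (hinv : PhiInvL H K φ) (h : H) :
    ((φ h : K) : B) ∈ H ↔ (h : B) ∈ K := by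
  have key : φ h ∈ ((H ⊓ K).subgroupOf H).map φ.toMonoidHom ↔ φ h ∈ (H ⊓ K).subgroupOf K := by
    rw [show ((H ⊓ K).subgroupOf H).map φ.toMonoidHom = _ from hinv]
  have hmap : φ h ∈ ((H ⊓ K).subgroupOf H).map φ.toMonoidHom ↔ h ∈ (H ⊓ K).subgroupOf H :=
    Subgroup.mem_map_iff_mem (f := φ.toMonoidHom) φ.injective
  rw [hmap] at key
  simpa [Subgroup.mem_subgroupOf] using key.symm

variable {H K φ} in
theorem ker_BKHmaps (hinv : PhiInvL H K φ) (i : Bool) :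
    (BKHmaps H K φ i).ker = (H ⊓ K).subgroupOf H := by
  cases i
  · ext h
    have h1 : h ∈ (BKHmaps H K φ false).ker ↔ ((φ h : K) : B) ∈ H :=
      QuotientGroup.eq_one_iff ((φ h : K) : B)
    rw [h1, hinv.apply_mem_iff]
    simp [Subgroup.mem_subgroupOf]
  · ext h
    have h1 : h ∈ (BKHmaps H K φ true).ker ↔ (h : B) ∈ K := QuotientGroup.eq_one_iff (h : B)
    rw [h1]
    simp [Subgroup.mem_subgroupOf]

/-- The canonical map of a factor to `𝔹_{K,H}`. -/
def BKHof (i : Bool) : BKHfactors H K i →* BKH H K φ :=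
  Monoid.PushoutI.of i

/-- The canonical map of `H` to `𝔹_{K,H}`. -/
def BKHbase : H →* BKH H K φ :=
  Monoid.PushoutI.base (BKHmaps H K φ)

theorem BKHof_BKHmaps (i : Bool) (h : H) :
    BKHof H K φ i (BKHmaps H K φ i h) = BKHbase H K φ h :=
  Monoid.PushoutI.of_apply_eq_base (BKHmaps H K φ) i h

theorem mem_BKHamalg {x : BKH H K φ} : x ∈ BKHamalg H K φ ↔ ∃ h, BKHbase H K φ h = x :=
  Iff.rfl

variable {H K φ} in
theorem BKHof_injective (hinv : PhiInvL H K φ) (i : Bool) :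
    Function.Injective (BKHof H K φ i) :=
  pushoutI_of_injective_of_ker_eq (ker_BKHmaps hinv) i

theorem range_BKHmaps_normal (i : Bool) : (BKHmaps H K φ i).range.Normal := by
  cases i
  · refine ⟨?_⟩
    rintro _ ⟨h, rfl⟩ g
    obtain ⟨b, rfl⟩ := QuotientGroup.mk'_surjective H g
    refine ⟨φ.symm ⟨b * (φ h : K) * b⁻¹, ‹K.Normal›.conj_mem _ (φ h).2 b⟩, ?_⟩
    change QuotientGroup.mk' H ((φ (φ.symm _) : K) : B) = _
    rw [φ.apply_symm_apply, map_mul, map_mul, map_inv]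
    rfl
  · refine ⟨?_⟩
    rintro _ ⟨h, rfl⟩ g
    obtain ⟨b, rfl⟩ := QuotientGroup.mk'_surjective K g
    refine ⟨⟨b * h * b⁻¹, ‹H.Normal›.conj_mem _ h.2 b⟩, ?_⟩
    change QuotientGroup.mk' K (b * h * b⁻¹) = _
    rw [map_mul, map_mul, map_inv]
    rfl

instance BKHamalg_normal : (BKHamalg H K φ).Normal := by
  refine ⟨fun u hu x => ?_⟩
  revert u
  induction x using Monoid.PushoutI.induction_on with
  | of i g =>
    rintro _ ⟨h, rfl⟩
    obtain ⟨h', hh'⟩ := (range_BKHmaps_normal H K φ i).conj_mem _ ⟨h, rfl⟩ g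
    refine ⟨h', ?_⟩
    change BKHbase H K φ h' = BKHof H K φ i g * BKHbase H K φ h * (BKHof H K φ i g)⁻¹
    rw [← BKHof_BKHmaps H K φ i, ← BKHof_BKHmaps H K φ i, hh', map_mul, map_mul, map_inv]
  | base h =>
    rintro u hu
    exact mul_mem (mul_mem ⟨h, rfl⟩ hu) (inv_mem ⟨h, rfl⟩)
  | mul x y hx hy =>
    intro u hu
    have hxy : ∀ x y : BKH H K φ, x * (y * u * y⁻¹) * x⁻¹ = x * y * u * (x * y)⁻¹ :=
      fun x y => by group
    exact hxy x y ▸ hx _ (hy u hu)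

variable {H K φ} in
theorem IsRootClass.BKHamalg {C : GroupClass.{u}} (hC : IsRootClass C) (hinv : PhiInvL H K φ)
    (hBK : C (B ⧸ K)) : C (BKHamalg H K φ) := by
  have hle : _root_.BKHamalg H K φ ≤ (BKHof H K φ true).range := by
    rintro _ ⟨h, rfl⟩
    exact ⟨_, BKHof_BKHmaps H K φ true h⟩
  have hrange : C (BKHof H K φ true).range :=
    hC.of_mulEquiv (MonoidHom.ofInjective (BKHof_injective hinv true)) hBK
  exact hC.of_injective (Subgroup.inclusion hle) (Subgroup.inclusion_injective hle) hrange

/-- The map `B → B/K → 𝔹_{K,H}`. -/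
def toBKHtrue : B →* BKH H K φ :=
  (BKHof H K φ true).comp (QuotientGroup.mk' K)

/-- The map `B → B/H → 𝔹_{K,H}`. -/
def toBKHfalse : B →* BKH H K φ :=
  (BKHof H K φ false).comp (QuotientGroup.mk' H)

theorem toBKHtrue_coe (h : H) : toBKHtrue H K φ h = BKHbase H K φ h :=
  BKHof_BKHmaps H K φ true h

theorem toBKHfalse_coe (h : H) : toBKHfalse H K φ (φ h : K) = BKHbase H K φ h :=
  BKHof_BKHmaps H K φ false h

variable {H K φ}

theorem toBKHtrue_eq_one_iff (hinv : PhiInvL H K φ) (b : B) :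
    toBKHtrue H K φ b = 1 ↔ b ∈ K :=
  (map_eq_one_iff _ (BKHof_injective hinv true)).trans (QuotientGroup.eq_one_iff b)

theorem toBKHfalse_eq_one_iff (hinv : PhiInvL H K φ) (b : B) :
    toBKHfalse H K φ b = 1 ↔ b ∈ H :=
  (map_eq_one_iff _ (BKHof_injective hinv false)).trans (QuotientGroup.eq_one_iff b)

theorem toBKHtrue_mem (b : B) (hb : b ∈ H ⊔ K) :
    toBKHtrue H K φ b ∈ BKHamalg H K φ := by
  refine (sup_le ?_ ?_ : H ⊔ K ≤ (BKHamalg H K φ).comap (toBKHtrue H K φ)) hb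
  · intro h hh
    exact ⟨⟨h, hh⟩, (toBKHtrue_coe H K φ ⟨h, hh⟩).symm⟩
  · intro k hk
    have h1 : QuotientGroup.mk' K k = 1 := (QuotientGroup.eq_one_iff k).2 hk
    have h2 : toBKHtrue H K φ k = 1 := (congrArg (BKHof H K φ true) h1).trans (map_one _)
    rw [Subgroup.mem_comap, h2]
    exact one_mem _

theorem toBKHfalse_mem (b : B) (hb : b ∈ H ⊔ K) :
    toBKHfalse H K φ b ∈ BKHamalg H K φ := by
  refine (sup_le ?_ ?_ : H ⊔ K ≤ (BKHamalg H K φ).comap (toBKHfalse H K φ)) hb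
  · intro h hh
    have h1 : QuotientGroup.mk' H h = 1 := (QuotientGroup.eq_one_iff h).2 hh
    have h2 : toBKHfalse H K φ h = 1 := (congrArg (BKHof H K φ false) h1).trans (map_one _)
    rw [Subgroup.mem_comap, h2]
    exact one_mem _
  · intro k hk
    obtain ⟨h, hh⟩ := φ.surjective ⟨k, hk⟩
    exact ⟨h, by have := toBKHfalse_coe H K φ h; rw [hh] at this; exact this.symm⟩

/-- `𝔹_{K,H}` has a quotient in the class in which both factors embed; it is given here by the
induced maps of `B`. -/
theorem IsRootClass.exists_homs_with_ker {C : GroupClass.{u}} (hC : IsRootClass C)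
    (hinv : PhiInvL H K φ) (hBK : C (B ⧸ K)) (hBHK : C (B ⧸ (H ⊔ K)))
    (hAut : C ↥(autOf (BKH H K φ) (_root_.BKHamalg H K φ))) :
    ∃ (D : Type u) (_ : Group D) (a b : B →* D), C D ∧ a.ker = K ∧ b.ker = H ∧
      ∀ h : H, a h = b (φ h : K) := by
  have hker : ∀ v : B, v ∈ (QuotientGroup.mk' (H ⊔ K)).ker ↔ v ∈ H ⊔ K := fun v => by
    rw [QuotientGroup.ker_mk']
  obtain ⟨a, -, ha', ha⟩ := exists_hom_wreath_autExtension (_root_.BKHamalg H K φ)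
    (toBKHtrue H K φ) (QuotientGroup.mk' (H ⊔ K)) fun v hv => toBKHtrue_mem v ((hker v).1 hv)
  obtain ⟨b, -, hb', hb⟩ := exists_hom_wreath_autExtension (_root_.BKHamalg H K φ)
    (toBKHfalse H K φ) (QuotientGroup.mk' (H ⊔ K)) fun v hv => toBKHfalse_mem v ((hker v).1 hv)
  refine ⟨_, inferInstance, a, b, hC.regularWreathProduct
    (hC.semidirectProduct _ (hC.BKHamalg hinv hBK) hAut) hBHK, ?_, ?_, fun h => ?_⟩
  · ext v
    rw [MonoidHom.mem_ker, ha, hker, toBKHtrue_eq_one_iff hinv]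
    exact and_iff_right_of_imp fun hv => le_sup_right (a := H) hv
  · ext v
    rw [MonoidHom.mem_ker, hb, hker, toBKHfalse_eq_one_iff hinv]
    exact and_iff_right_of_imp fun hv => le_sup_left (b := K) hv
  · rw [ha' _ ((hker _).2 (le_sup_left (b := K) h.2)),
      hb' _ ((hker _).2 (le_sup_right (a := H) (φ h).2))]
    simp only [toBKHtrue_coe, toBKHfalse_coe]

end BKHLemmas

section HNNLemmas

variable {B : Type u} [Group B] {H K : Subgroup B} {φ : H ≃* K}

/-- Two homomorphisms `a`, `b` of `B` that agree along `φ` combine to a homomorphism of the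
HNN-extension to a wreath product, with `t` going to `y` in the top group. -/
theorem exists_hom_wreath_of_homs {D Y : Type*} [Group D] [Group Y] (a b : B →* D)
    (hab : ∀ h : H, a h = b (φ h : K)) (haK : a.ker = K) (hbH : b.ker = H) {y : Y} (hy : y ≠ 1) :
    ∃ f : HNNExtension B H K φ →* RegularWreathProduct D Y,
      ∀ v, f (HNNExtension.of v) = 1 ↔ v ∈ H ⊓ K := by
  classical
  have hK : ∀ k : K, a k = 1 := fun k => by
    rw [← MonoidHom.mem_ker, haK]; exact k.2
  have hH : ∀ h : H, b h = 1 := fun h => by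
    rw [← MonoidHom.mem_ker, hbH]; exact h.2
  let ρ : B →* RegularWreathProduct D Y := MonoidHom.mk'
    (fun v => ⟨fun s => if s = 1 then a v else if s = y then b v else 1, 1⟩) fun v w => by
      refine RegularWreathProduct.ext (funext fun s => ?_) (by simp)
      simp only [RegularWreathProduct.mul_left, Pi.mul_apply, inv_one, one_mul, map_mul]
      split_ifs <;> simp
  refine ⟨HNNExtension.lift ρ ⟨1, y⟩ fun h => ?_, fun v => ?_⟩
  · refine RegularWreathProduct.ext (funext fun s => ?_) (by simp [ρ])
    have hs : y⁻¹ * s = 1 ↔ s = y := by rw [inv_mul_eq_one, eq_comm]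
    by_cases h1 : s = 1
    · subst h1
      simp [ρ, hK, hH, hy]
    · by_cases h2 : s = y
      · subst h2
        simp [ρ, hy, hab]
      · simp [ρ, hs, h1, h2, hH]
  · rw [HNNExtension.lift_of, Subgroup.mem_inf]
    have hv : (v ∈ H ↔ b v = 1) ∧ (v ∈ K ↔ a v = 1) := by
      constructor
      · rw [← hbH, MonoidHom.mem_ker]
      · rw [← haK, MonoidHom.mem_ker]
    rw [hv.1, hv.2]
    refine ⟨fun h => ?_, fun ⟨h1, h2⟩ => RegularWreathProduct.ext (funext fun s => ?_) rfl⟩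
    · have hl := congrArg RegularWreathProduct.left h
      have h1 := congrFun hl 1
      have h2 := congrFun hl y
      simp [ρ, hy] at h1 h2
      exact ⟨h2, h1⟩
    · simp [ρ, h1, h2]

theorem map_of_inf_normal [H.Normal] [K.Normal] (hinv : PhiInvL H K φ) :
    ((H ⊓ K).map (HNNExtension.of : B →* HNNExtension B H K φ)).Normal := by
  rw [← Subgroup.normalizer_eq_top_iff, eq_top_iff]
  rintro x -
  induction x using HNNExtension.induction_on with
  | of g =>
    refine Subgroup.le_normalizer_map _ ⟨g, ?_, rfl⟩
    rw [Subgroup.normalizer_eq_top]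
    trivial
  | t =>
    rw [Subgroup.mem_normalizer_iff]
    refine fun x => ⟨?_, ?_⟩
    · rintro ⟨l, hl, rfl⟩
      refine ⟨(φ ⟨l, hl.1⟩ : K), ⟨(hinv.apply_mem_iff ⟨l, hl.1⟩).2 hl.2, (φ _).2⟩, ?_⟩
      rw [HNNExtension.equiv_eq_conj]
    · rintro ⟨l, hl, hx⟩
      refine ⟨(φ.symm ⟨l, hl.2⟩ : H), ⟨(φ.symm _).2, ?_⟩, ?_⟩
      · refine (hinv.apply_mem_iff _).1 ?_
        rw [φ.apply_symm_apply]
        exact hl.1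
      · rw [HNNExtension.equiv_symm_eq_conj, hx]
        group
  | mul x y hx hy => exact mul_mem hx hy
  | inv x hx => exact inv_mem hx

/-- If `f` has kernel `L = H ⊓ K` on `B`, then it is covered by a homomorphism that is injective
on `B`, with values in a wreath product of `L ⋊ Aut_𝔼(L)` with the codomain of `f`. -/
theorem exists_hom_wreath_injective {S : Type*} [Group S] (f : HNNExtension B H K φ →* S)
    (hf : ∀ v, f (HNNExtension.of v) = 1 ↔ v ∈ H ⊓ K)
    (hnormal : ((H ⊓ K).map (HNNExtension.of : B →* HNNExtension B H K φ)).Normal) :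
    ∃ F : HNNExtension B H K φ →* RegularWreathProduct
        (AutExtension ((H ⊓ K).map (HNNExtension.of : B →* HNNExtension B H K φ))) S,
      Function.Injective (F.comp HNNExtension.of) := by
  set Y := (H ⊓ K).map (HNNExtension.of : B →* HNNExtension B H K φ)
  have hker : ∀ v, v ∈ (f.comp HNNExtension.of).ker ↔ v ∈ H ⊓ K := hf
  obtain ⟨ρ, hρ, hρ', hρone⟩ := exists_hom_wreath_autExtension Y HNNExtension.of
    (f.comp HNNExtension.of) fun v hv => ⟨v, (hker v).1 hv, rfl⟩
  let τ₀ : RegularWreathProduct (AutExtension Y) S :=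
    ⟨fun _ => SemidirectProduct.inr (conjAutOf Y HNNExtension.t), f HNNExtension.t⟩
  let ρ₁ : H →* RegularWreathProduct (AutExtension Y) S :=
    (MulAut.conj τ₀).toMonoidHom.comp (ρ.comp H.subtype)
  let ρ₂ : H →* RegularWreathProduct (AutExtension Y) S :=
    ρ.comp (K.subtype.comp φ.toMonoidHom)
  have hρ₁ : ∀ h, ρ₁ h = τ₀ * ρ h * τ₀⁻¹ := fun _ => rfl
  have hρ₂ : ∀ h, ρ₂ h = ρ (φ h : K) := fun _ => rfl
  have hright : ∀ h, (ρ₁ h).right = (ρ₂ h).right := fun h => by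
    simp [hρ₁, hρ₂, hρ, τ₀, HNNExtension.equiv_eq_conj]
  obtain ⟨κ, -, hκ⟩ := exists_conj_of_agree ρ₁ ρ₂ hright fun h hh => by
    have hφh : ((φ h : K) : B) ∈ (f.comp HNNExtension.of).ker := by
      rw [MonoidHom.mem_ker, ← hρ, ← hρ₂, ← hright, hh]
    have hhker : (h : B) ∈ (f.comp HNNExtension.of).ker := by
      rw [hright, hρ₂, hρ] at hh
      simpa [HNNExtension.equiv_eq_conj] using hh
    rw [hρ₁, hρ₂, hρ' _ hφh, hρ' _ hhker, mul_inv_eq_iff_eq_mul]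
    refine RegularWreathProduct.ext (funext fun s => ?_) (by simp)
    have hc := SemidirectProduct.inl_aut (φ := (autOf _ Y).subtype)
      (conjAutOf Y HNNExtension.t) ⟨HNNExtension.of (h : B), ⟨h, (hker h).1 hhker, rfl⟩⟩
    rw [map_inv, eq_mul_inv_iff_mul_eq] at hc
    refine hc.symm.trans (congrArg (· * _) (congrArg _ (Subtype.ext ?_)))
    simp [HNNExtension.equiv_eq_conj]
  refine ⟨HNNExtension.lift ρ (κ * τ₀) fun h => ?_, ?_⟩
  · have h1 := hκ h
    rw [hρ₁, hρ₂] at h1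
    rw [← mul_assoc, ← h1]
    group
  · rw [injective_iff_map_eq_one]
    intro v hv
    rw [MonoidHom.comp_apply, HNNExtension.lift_of] at hv
    exact (map_eq_one_iff _ (HNNExtension.of_injective φ)).1 ((hρone v).1 hv).2

end HNNLemmas

theorem statement_12 (C : GroupClass.{u}) (hroot : IsRootClass C)
    {B : Type u} [Group B] (H K : Subgroup B) (φ : H ≃* K)
    (hH : H.Normal) (hK : K.Normal)
    (hinv : PhiInvL H K φ)
    (hL : C ↥(H ⊓ K))
    (hBH : C (B ⧸ H)) (hBK : C (B ⧸ K)) (hBHK : C (B ⧸ (H ⊔ K)))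
    (hAutE : C ↥(autOf (HNNExtension B H K φ)
      ((H ⊓ K).map (HNNExtension.of : B →* HNNExtension B H K φ))))
    (hAut : C ↥(autOf (BKH H K φ) (BKHamalg H K φ))) :
    ∃ (G : Type u) (_ : Group G) (f : HNNExtension B H K φ →* G),
      Function.Surjective f ∧ C G ∧ Function.Injective (f.comp HNNExtension.of) := by
  have hnormal := map_of_inf_normal hinv
  obtain ⟨D, _, a, b, hD, haK, hbH, hab⟩ := hroot.exists_homs_with_ker hinv hBK hBHK hAut
  obtain ⟨Y, _, hY, hYnt⟩ := hroot.2.1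
  obtain ⟨y, hy⟩ := exists_ne (1 : Y)
  obtain ⟨f, hf⟩ := exists_hom_wreath_of_homs a b hab haK hbH hy
  obtain ⟨F, hF⟩ := exists_hom_wreath_injective f hf hnormal
  have hLmap := hroot.of_mulEquiv ((H ⊓ K).equivMapOfInjective
    (HNNExtension.of : B →* HNNExtension B H K φ) (HNNExtension.of_injective φ)) hL
  have hW := hroot.regularWreathProduct (hroot.semidirectProduct (autOf _ _).subtype hLmap hAutE)
    (hroot.regularWreathProduct hD hY)
  exact ⟨F.range, inferInstance, F.rangeRestrict, F.rangeRestrict_surjective,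
    hroot.of_subgroup _ hW, fun v w hvw => hF (congrArg Subtype.val hvw)⟩
end

section
/- Suppose the HNN-extension 𝔼 = ⟨B, t; t⁻¹Ht = K, φ⟩ satisfies condition (*) and Q is a normal (H,K,φ)-compatible subgroup of B; let 𝔼_Q = ⟨B/Q, t; t⁻¹(HQ/Q)t = KQ/Q, φ_Q⟩, and set 𝔥_Q = Aut_{B/Q}(HQ/Q), 𝔎_Q = φ_Q ∘ Aut_{B/Q}(KQ/Q) ∘ φ_Q⁻¹, and 𝔏_Q = Aut_{B/Q}(LQ/Q). Then: (1) there exists a surjective homomorphism of 𝔘 onto 𝔘_Q = ⟨𝔥_Q, 𝔎_Q⟩ which maps 𝔥 onto 𝔥_Q and 𝔎 onto 𝔎_Q; (2) the subgroup LQ/Q is φ_Q-invariant and there exists a surjective homomorphism of 𝔙 onto 𝔙_Q = ⟨𝔏_Q, φ_Q|_{LQ/Q}⟩ which maps 𝔏 onto 𝔏_Q and 𝔉 onto 𝔉_Q = ⟨φ_Q|_{LQ/Q}⟩. -/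
universe u

open Subgroup

/-- A relation `R` between two groups that is a subgroup of their product and is single-valued
induces a surjection between joins of corresponding subgroups. -/
theorem exists_surjective_sup_of_relation {G G' : Type*} [Group G] [Group G']
    (R : Subgroup (G × G')) (hR : ∀ b, (1, b) ∈ R → b = 1) (A C : Subgroup G)
    (A' C' : Subgroup G')
    (hA : ∀ a ∈ A, ∃ a' ∈ A', (a, a') ∈ R) (hA' : ∀ a' ∈ A', ∃ a ∈ A, (a, a') ∈ R)
    (hC : ∀ c ∈ C, ∃ c' ∈ C', (c, c') ∈ R) (hC' : ∀ c' ∈ C', ∃ c ∈ C, (c, c') ∈ R) :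
    ∃ f : ↥(A ⊔ C) →* ↥(A' ⊔ C'), Function.Surjective f ∧
      (A.subgroupOf (A ⊔ C)).map f = A'.subgroupOf (A' ⊔ C') ∧
      (C.subgroupOf (A ⊔ C)).map f = C'.subgroupOf (A' ⊔ C') := by
  have uniq : ∀ a b b', (a, b) ∈ R → (a, b') ∈ R → b = b' := fun a b b' h h' => by
    have := hR (b * b'⁻¹) (by simpa using R.mul_mem h (R.inv_mem h'))
    exact mul_inv_eq_one.mp this
  have total : A ⊔ C ≤ (R ⊓ (A' ⊔ C').comap (MonoidHom.snd G G')).map (MonoidHom.fst G G') := by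
    refine sup_le (fun a ha => ?_) fun c hc => ?_
    · obtain ⟨a', ha', h⟩ := hA a ha
      exact ⟨(a, a'), ⟨h, mem_sup_left ha'⟩, rfl⟩
    · obtain ⟨c', hc', h⟩ := hC c hc
      exact ⟨(c, c'), ⟨h, mem_sup_right hc'⟩, rfl⟩
  have onto : A' ⊔ C' ≤ (R ⊓ (A ⊔ C).comap (MonoidHom.fst G G')).map (MonoidHom.snd G G') := by
    refine sup_le (fun a' ha' => ?_) fun c' hc' => ?_
    · obtain ⟨a, ha, h⟩ := hA' a' ha'
      exact ⟨(a, a'), ⟨h, mem_sup_left ha⟩, rfl⟩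
    · obtain ⟨c, hc, h⟩ := hC' c' hc'
      exact ⟨(c, c'), ⟨h, mem_sup_right hc⟩, rfl⟩
  have ex : ∀ x : ↥(A ⊔ C), ∃ y : ↥(A' ⊔ C'), ((x : G), (y : G')) ∈ R := by
    rintro ⟨x, hx⟩
    obtain ⟨⟨_, y⟩, ⟨h, hy⟩, rfl⟩ := total hx
    exact ⟨⟨y, hy⟩, h⟩
  choose F hF using ex
  have eqF : ∀ (x : ↥(A ⊔ C)) (y : ↥(A' ⊔ C')), ((x : G), (y : G')) ∈ R → F x = y :=
    fun x y h => Subtype.ext (uniq _ _ _ (hF x) h)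
  have mapF : ∀ (D : Subgroup G) (D' : Subgroup G') (f : ↥(A ⊔ C) →* ↥(A' ⊔ C')),
      (∀ x, f x = F x) → D ≤ A ⊔ C → (∀ d ∈ D, ∃ d' ∈ D', (d, d') ∈ R) →
      (∀ d' ∈ D', ∃ d ∈ D, (d, d') ∈ R) →
      (D.subgroupOf (A ⊔ C)).map f = D'.subgroupOf (A' ⊔ C') := by
    intro D D' f hf hle hD hD'
    ext y
    constructor
    · rintro ⟨x, hx, rfl⟩
      obtain ⟨d', hd', h⟩ := hD x hx
      rw [mem_subgroupOf, hf, uniq _ _ _ (hF x) h]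
      exact hd'
    · intro hy
      obtain ⟨d, hd, h⟩ := hD' y hy
      exact ⟨⟨d, hle hd⟩, hd, (hf _).trans (eqF _ _ h)⟩
  refine ⟨MonoidHom.mk' F fun x y => eqF _ _ (R.mul_mem (hF x) (hF y)), ?_,
    mapF A A' _ (fun _ => rfl) le_sup_left hA hA', mapF C C' _ (fun _ => rfl) le_sup_right hC hC'⟩
  rintro ⟨y, hy⟩
  obtain ⟨⟨x, _⟩, ⟨h, hx⟩, rfl⟩ := onto hy
  exact ⟨⟨x, hx⟩, eqF _ _ h⟩

/-- Pairs of automorphisms that are intertwined by the homomorphism `p`. -/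
def intertwinedAut {X Y : Type*} [Group X] [Group Y] (p : X →* Y) :
    Subgroup (MulAut X × MulAut Y) where
  carrier := {α | ∀ x, p (α.1 x) = α.2 (p x)}
  one_mem' := fun _ => rfl
  mul_mem' := by
    intro α β hα hβ x
    change p (α.1 (β.1 x)) = α.2 (β.2 (p x))
    rw [hα, hβ]
  inv_mem' := by
    intro α hα x
    have h := hα (α.1⁻¹ x)
    rw [MulAut.apply_inv_self] at h
    change p (α.1⁻¹ x) = α.2⁻¹ (p x)
    rw [h, MulAut.inv_apply_self]

theorem eq_one_of_intertwinedAut {X Y : Type*} [Group X] [Group Y] {p : X →* Y}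
    (hp : Function.Surjective p) (β : MulAut Y) (h : (1, β) ∈ intertwinedAut p) : β = 1 := by
  ext y
  obtain ⟨x, rfl⟩ := hp y
  exact (h x).symm

theorem exists_intertwined_autOf_map {X Y : Type u} [Group X] [Group Y] {p : X →* Y}
    (hp : Function.Surjective p) {N : Subgroup X} (hN : N.Normal) (α : MulAut N)
    (hα : α ∈ autOf X N) :
    ∃ β ∈ autOf Y (N.map p), (α, β) ∈ intertwinedAut (p.subgroupMap N) := by
  obtain ⟨a, ha⟩ := hα
  have := hN.map p hp
  refine ⟨MulAut.conjNormal (p a), ⟨p a, fun _ => MulAut.conjNormal_apply _ _⟩, fun x => ?_⟩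
  apply Subtype.ext
  change p (α x : N) = p a * p x * (p a)⁻¹
  rw [ha]
  simp

theorem exists_autOf_intertwined {X Y : Type u} [Group X] [Group Y] {p : X →* Y}
    (hp : Function.Surjective p) {N : Subgroup X} (hN : N.Normal) (β : MulAut (N.map p))
    (hβ : β ∈ autOf Y (N.map p)) :
    ∃ α ∈ autOf X N, (α, β) ∈ intertwinedAut (p.subgroupMap N) := by
  obtain ⟨b, hb⟩ := hβ
  obtain ⟨a, rfl⟩ := hp b
  refine ⟨MulAut.conjNormal a, ⟨a, fun _ => MulAut.conjNormal_apply _ _⟩, fun x => ?_⟩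
  apply Subtype.ext
  rw [hb]
  change p (a * x * a⁻¹) = p a * p x * (p a)⁻¹
  simp

theorem autConjHom_mem_intertwinedAut {H K H' K' : Type u} [Group H] [Group K] [Group H']
    [Group K'] {p : H →* H'} {q : K →* K'} {φ : H ≃* K} {φ' : H' ≃* K'}
    (h : ∀ x, q (φ x) = φ' (p x)) {γ : MulAut K} {δ : MulAut K'}
    (hγ : (γ, δ) ∈ intertwinedAut q) :
    (autConjHom φ γ, autConjHom φ' δ) ∈ intertwinedAut p := by
  intro x
  change p (φ.symm (γ (φ x))) = φ'.symm (δ (φ' (p x)))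
  rw [MulEquiv.eq_symm_apply, ← h, ← h, MulEquiv.apply_symm_apply]
  exact hγ (φ x)

/-- The automorphism of a subgroup `M` induced by an isomorphism `φ` between larger subgroups
mapping `M` onto itself. -/
theorem exists_mulAut_restrict {G : Type*} [Group G] {H K M : Subgroup G} (φ : H ≃* K)
    (hM : M ≤ H) (hmem : ∀ x (hx : x ∈ M), (φ ⟨x, hM hx⟩ : G) ∈ M)
    (hsurj : ∀ y ∈ M, ∃ x, ∃ hx : x ∈ M, (φ ⟨x, hM hx⟩ : G) = y) :
    ∃ ψ : MulAut M, ∀ x : M, (ψ x : G) = φ ⟨x, hM x.2⟩ := by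
  let f : M →* M :=
    (K.subtype.comp (φ.toMonoidHom.comp (inclusion hM))).codRestrict M fun x => hmem x x.2
  have hf : Function.Bijective f := by
    constructor
    · intro x y hxy
      have h : (φ ⟨x, hM x.2⟩ : G) = φ ⟨y, hM y.2⟩ :=
        congrArg M.subtype hxy
      have h' := φ.injective (Subtype.ext h)
      exact Subtype.ext (Subtype.mk.inj h')
    · rintro ⟨y, hy⟩
      obtain ⟨x, hx, h⟩ := hsurj y hy
      exact ⟨⟨x, hx⟩, Subtype.ext h⟩
  exact ⟨MulEquiv.ofBijective f hf, fun _ => rfl⟩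

theorem statement_13
    {B : Type u} [Group B] (H K : Subgroup B) (φ : H ≃* K)
    (hH : H.Normal) (hK : K.Normal)
    (ψ : MulAut ↥(H ⊓ K)) (hψ : IsRestrictionToL H K φ ψ)
    (Q : Subgroup B) (hQ : Q.Normal)
    (hcompat : ((Q ⊓ H).subgroupOf H).map φ.toMonoidHom = (Q ⊓ K).subgroupOf K)
    (φQ : ↥(H.map (QuotientGroup.mk' Q)) ≃* ↥(K.map (QuotientGroup.mk' Q)))
    (hφQ : ∀ h : ↥H,
      ((φQ ⟨(QuotientGroup.mk' Q) ↑h, Subgroup.mem_map_of_mem _ h.2⟩ :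
          ↥(K.map (QuotientGroup.mk' Q))) : B ⧸ Q) =
        (QuotientGroup.mk' Q) ↑(φ h)) :
    (∃ f : ↥(frakU H K φ) →*
        ↥(frakU (H.map (QuotientGroup.mk' Q)) (K.map (QuotientGroup.mk' Q)) φQ),
      Function.Surjective f ∧
      ((autOf B H).subgroupOf (frakU H K φ)).map f =
        (autOf (B ⧸ Q) (H.map (QuotientGroup.mk' Q))).subgroupOf
          (frakU (H.map (QuotientGroup.mk' Q)) (K.map (QuotientGroup.mk' Q)) φQ) ∧
      ((frakK H K φ).subgroupOf (frakU H K φ)).map f =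
        (frakK (H.map (QuotientGroup.mk' Q)) (K.map (QuotientGroup.mk' Q)) φQ).subgroupOf
          (frakU (H.map (QuotientGroup.mk' Q)) (K.map (QuotientGroup.mk' Q)) φQ)) ∧
    (∃ ψQ : MulAut ↥((H ⊓ K).map (QuotientGroup.mk' Q)),
      (∀ x : ↥((H ⊓ K).map (QuotientGroup.mk' Q)),
        ((ψQ x : ↥((H ⊓ K).map (QuotientGroup.mk' Q))) : B ⧸ Q) =
          ((φQ ⟨(x : B ⧸ Q), Subgroup.map_mono inf_le_left x.2⟩ :
              ↥(K.map (QuotientGroup.mk' Q))) : B ⧸ Q)) ∧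
      ∃ g : ↥(frakV H K ψ) →*
          ↥(autOf (B ⧸ Q) ((H ⊓ K).map (QuotientGroup.mk' Q)) ⊔ Subgroup.zpowers ψQ),
        Function.Surjective g ∧
        ((autOf B (H ⊓ K)).subgroupOf (frakV H K ψ)).map g =
          (autOf (B ⧸ Q) ((H ⊓ K).map (QuotientGroup.mk' Q))).subgroupOf
            (autOf (B ⧸ Q) ((H ⊓ K).map (QuotientGroup.mk' Q)) ⊔ Subgroup.zpowers ψQ) ∧
        ((Subgroup.zpowers ψ).subgroupOf (frakV H K ψ)).map g =
          (Subgroup.zpowers ψQ).subgroupOf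
            (autOf (B ⧸ Q) ((H ⊓ K).map (QuotientGroup.mk' Q)) ⊔ Subgroup.zpowers ψQ)) := by
  have hp := QuotientGroup.mk'_surjective Q
  have hφ : ∀ x : H, (QuotientGroup.mk' Q).subgroupMap K (φ x) =
      φQ ((QuotientGroup.mk' Q).subgroupMap H x) := fun x => Subtype.ext (hφQ x).symm
  have hL : (H ⊓ K).Normal := inferInstance
  refine ⟨?_, ?_⟩
  · refine exists_surjective_sup_of_relation
      (intertwinedAut ((QuotientGroup.mk' Q).subgroupMap H))
      (eq_one_of_intertwinedAut (MonoidHom.subgroupMap_surjective _ _)) _ _ _ _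
      (exists_intertwined_autOf_map hp hH) (exists_autOf_intertwined hp hH) ?_ ?_
    · rintro _ ⟨γ, hγ, rfl⟩
      obtain ⟨δ, hδ, h⟩ := exists_intertwined_autOf_map hp hK γ hγ
      exact ⟨_, mem_map_of_mem _ hδ, autConjHom_mem_intertwinedAut hφ h⟩
    · rintro _ ⟨δ, hδ, rfl⟩
      obtain ⟨γ, hγ, h⟩ := exists_autOf_intertwined hp hK δ hδ
      exact ⟨_, mem_map_of_mem _ hγ, autConjHom_mem_intertwinedAut hφ h⟩
  · have hφL : ∀ l : ↥(H ⊓ K), (φQ ⟨QuotientGroup.mk' Q l, mem_map_of_mem _ l.2.1⟩ : B ⧸ Q) =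
        QuotientGroup.mk' Q (ψ l) := fun l => by
      rw [hψ]
      exact hφQ ⟨l, l.2.1⟩
    obtain ⟨ψQ, hψQ⟩ := exists_mulAut_restrict (M := (H ⊓ K).map (QuotientGroup.mk' Q)) φQ
      (map_mono inf_le_left)
      (by
        rintro _ ⟨l, hl, rfl⟩
        exact (hφL ⟨l, hl⟩).symm ▸ mem_map_of_mem _ (ψ ⟨l, hl⟩).2)
      (by
        rintro _ ⟨l, hl, rfl⟩
        refine ⟨_, mem_map_of_mem _ (ψ⁻¹ ⟨l, hl⟩).2, (hφL (ψ⁻¹ ⟨l, hl⟩)).trans ?_⟩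
        rw [MulAut.apply_inv_self])
    have hmem : (ψ, ψQ) ∈ intertwinedAut ((QuotientGroup.mk' Q).subgroupMap (H ⊓ K)) :=
      fun x => Subtype.ext ((hφL x).symm.trans (hψQ ((QuotientGroup.mk' Q).subgroupMap _ x)).symm)
    refine ⟨ψQ, hψQ, exists_surjective_sup_of_relation
      (intertwinedAut ((QuotientGroup.mk' Q).subgroupMap (H ⊓ K)))
      (eq_one_of_intertwinedAut (MonoidHom.subgroupMap_surjective _ _)) _ _ _ _
      (exists_intertwined_autOf_map hp hL) (exists_autOf_intertwined hp hL) ?_ ?_⟩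
    · rintro _ ⟨n, rfl⟩
      exact ⟨ψQ ^ n, zpow_mem_zpowers _ _, zpow_mem hmem n⟩
    · rintro _ ⟨n, rfl⟩
      exact ⟨ψ ^ n, zpow_mem_zpowers _ _, zpow_mem hmem n⟩
end
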